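/- arXiv:1302.6757 — 2 statements merged into one kernel-verified Lean document; each statement's English description precedes it below -/
import Mathlib

section
/- Let σ_P, σ_R, p, r > 0 and δ > 0, and let β = √((2r/σ_R² − 1)² + 8δ/σ_R²) − 1. For every λ with 0 < λ < β + 1, E(x, λ) → +∞ as x → +∞. -/
open Real Filter MeasureTheory Set

/-- The fundamental solution `D(x, λ)` of Paulsen–Gjessing (1997a), used in
Examples 3.2, 4.1 and 4.2 of Yin–Wen:
`D(x,λ) = σP^{-(1+β)} σR^{-(1+λ)} ∫_{arctan(σR x/σP)}^{π/2}
  (cos t)^{β-λ} (σP sin t - σR x cos t)^λ exp(-2pt/(σPσR)) dt`. -/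
noncomputable def Dfun (σP σR p β x lam : ℝ) : ℝ :=
  σP ^ (-(1 + β)) * σR ^ (-(1 + lam)) *
    ∫ t in Real.arctan (σR * x / σP)..(Real.pi / 2),
      Real.cos t ^ (β - lam) * (σP * Real.sin t - σR * x * Real.cos t) ^ lam *
        Real.exp (-2 * p * t / (σP * σR))

/-- The fundamental solution `E(x, λ)` of Paulsen–Gjessing (1997a):
`E(x,λ) = σP^{-(1+β)} σR^{-(1+λ)} ∫_{-π/2}^{arctan(σR x/σP)}
  (cos t)^{β-λ} (σR x cos t - σP sin t)^λ exp(-2pt/(σPσR)) dt`. -/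
noncomputable def Efun (σP σR p β x lam : ℝ) : ℝ :=
  σP ^ (-(1 + β)) * σR ^ (-(1 + lam)) *
    ∫ t in (-(Real.pi / 2))..Real.arctan (σR * x / σP),
      Real.cos t ^ (β - lam) * (σR * x * Real.cos t - σP * Real.sin t) ^ lam *
        Real.exp (-2 * p * t / (σP * σR))

/-- A power `s > -1` of the sine is integrable up to the zero at the origin. -/
theorem intervalIntegrable_sin_rpow {s b : ℝ} (hs : -1 < s) (hb : 0 ≤ b) (hbπ : b < Real.pi) :
    IntervalIntegrable (fun t => Real.sin t ^ s) volume 0 b := by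
  have hsinc : ∀ t ∈ Icc 0 b, 0 < Real.sinc t := by
    rintro t ⟨h0, h1⟩
    rcases h0.eq_or_lt with rfl | h0
    · simp
    · rw [Real.sinc_of_ne_zero h0.ne']
      exact div_pos (Real.sin_pos_of_pos_of_lt_pi h0 (h1.trans_lt hbπ)) h0
  have hcont : ContinuousOn (fun t => Real.sinc t ^ s) (uIcc 0 b) := by
    rw [uIcc_of_le hb]
    exact Real.continuous_sinc.continuousOn.rpow_const fun t ht => Or.inl (hsinc t ht).ne'
  refine ((intervalIntegral.intervalIntegrable_rpow' hs).mul_continuousOn hcont).congr ?_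
  intro t ht
  rw [uIoc_of_le hb] at ht
  have h := hsinc t (Ioc_subset_Icc_self ht)
  change t ^ s * Real.sinc t ^ s = Real.sin t ^ s
  rw [← Real.mul_rpow ht.1.le h.le, Real.sinc_of_ne_zero ht.1.ne', mul_div_cancel₀ _ ht.1.ne']

/-- A power `s > -1` of the cosine is integrable up to the zero at `-π / 2`. -/
theorem intervalIntegrable_cos_rpow {s a : ℝ} (hs : -1 < s) (ha : -(Real.pi / 2) ≤ a)
    (ha' : a < Real.pi / 2) :
    IntervalIntegrable (fun t => Real.cos t ^ s) volume (-(Real.pi / 2)) a := by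
  have h := (intervalIntegrable_sin_rpow hs (b := a + Real.pi / 2) (by linarith)
    (by linarith)).comp_add_right (Real.pi / 2)
  simpa [Real.sin_add_pi_div_two] using h

/-- The integrand of `Efun` is integrable. -/
theorem intervalIntegrable_Efun_integrand (σP σR p β x : ℝ) {lam : ℝ} (hlam : 0 < lam)
    (hlamβ : lam < β + 1) {a : ℝ} (ha : -(Real.pi / 2) ≤ a) (ha' : a < Real.pi / 2) :
    IntervalIntegrable (fun t => Real.cos t ^ (β - lam) *
      (σR * x * Real.cos t - σP * Real.sin t) ^ lam * Real.exp (-2 * p * t / (σP * σR)))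
      volume (-(Real.pi / 2)) a := by
  have hbase : Continuous fun t => (σR * x * Real.cos t - σP * Real.sin t) ^ lam :=
    Continuous.rpow_const (by fun_prop) fun _ => Or.inr hlam.le
  have hexp : Continuous fun t => Real.exp (-2 * p * t / (σP * σR)) := by fun_prop
  exact ((intervalIntegrable_cos_rpow (by linarith) ha ha').mul_continuousOn
    hbase.continuousOn).mul_continuousOn hexp.continuousOn

/-- The base of the power in the integrand of `Efun` is nonnegative on the range of integration. -/
theorem Efun_base_nonneg {σP σR x t : ℝ} (hσP : 0 < σP) (ht : -(Real.pi / 2) < t)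
    (hta : t ≤ Real.arctan (σR * x / σP)) :
    0 ≤ σR * x * Real.cos t - σP * Real.sin t := by
  have ht' : t < Real.pi / 2 := hta.trans_lt (Real.arctan_lt_pi_div_two _)
  have hc : 0 < Real.cos t := Real.cos_pos_of_mem_Ioo ⟨ht, ht'⟩
  have htan : Real.tan t ≤ σR * x / σP := by
    rw [← Real.arctan_le_arctan_iff, Real.arctan_tan ht ht']
    exact hta
  rw [Real.tan_eq_sin_div_cos, div_le_div_iff₀ hc hσP] at htan
  linarith

/-- On `[-π / 4, 0]` the integrand of `Efun` dominates `(σR x) ^ lam (cos t) ^ β`. -/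
theorem le_Efun_integrand {σP σR p β x lam t : ℝ} (hσP : 0 < σP) (hσR : 0 < σR) (hp : 0 < p)
    (hlam : 0 < lam) (hx : 0 ≤ x) (ht : t ∈ Icc (-(Real.pi / 4)) 0) :
    (σR * x) ^ lam * Real.cos t ^ β ≤ Real.cos t ^ (β - lam) *
      (σR * x * Real.cos t - σP * Real.sin t) ^ lam * Real.exp (-2 * p * t / (σP * σR)) := by
  obtain ⟨h1, h0⟩ := ht
  have hπ := Real.pi_pos
  have hc : 0 < Real.cos t := Real.cos_pos_of_mem_Ioo ⟨by linarith, by linarith⟩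
  have hs : Real.sin t ≤ 0 := Real.sin_nonpos_of_nonpos_of_neg_pi_le h0 (by linarith)
  have hσx : 0 ≤ σR * x := by positivity
  have hexp : 1 ≤ Real.exp (-2 * p * t / (σP * σR)) := by
    refine Real.one_le_exp (div_nonneg ?_ (by positivity))
    nlinarith
  have hbase : (σR * x * Real.cos t) ^ lam ≤
      (σR * x * Real.cos t - σP * Real.sin t) ^ lam :=
    Real.rpow_le_rpow (by positivity) (by nlinarith) hlam.le
  have hpos : 0 ≤ (σR * x * Real.cos t) ^ lam := by positivity
  calc (σR * x) ^ lam * Real.cos t ^ β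
      = Real.cos t ^ (β - lam) * (σR * x * Real.cos t) ^ lam := by
        rw [Real.mul_rpow hσx hc.le, mul_left_comm, ← Real.rpow_add hc, sub_add_cancel]
    _ ≤ Real.cos t ^ (β - lam) * (σR * x * Real.cos t - σP * Real.sin t) ^ lam := by gcongr
    _ ≤ _ := le_mul_of_one_le_right
        (mul_nonneg (Real.rpow_nonneg hc.le _) (hpos.trans hbase)) hexp

/-- A power lower bound for the integral in `Efun`. -/
theorem rpow_mul_integral_le_Efun_integral {σP σR p β x lam : ℝ} (hσP : 0 < σP) (hσR : 0 < σR)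
    (hp : 0 < p) (hlam : 0 < lam) (hlamβ : lam < β + 1) (hx : 0 ≤ x) :
    (σR * x) ^ lam * ∫ t in (-(Real.pi / 4))..0, Real.cos t ^ β ≤
      ∫ t in (-(Real.pi / 2))..Real.arctan (σR * x / σP),
        Real.cos t ^ (β - lam) * (σR * x * Real.cos t - σP * Real.sin t) ^ lam *
          Real.exp (-2 * p * t / (σP * σR)) := by
  have hπ := Real.pi_pos
  have hA : 0 ≤ Real.arctan (σR * x / σP) := Real.arctan_nonneg.2 (by positivity)
  have hA' := Real.arctan_lt_pi_div_two (σR * x / σP)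
  have hint := intervalIntegrable_Efun_integrand σP σR p β x hlam hlamβ
    (a := Real.arctan (σR * x / σP)) (by linarith) hA'
  have hsub : uIcc (-(Real.pi / 4)) 0 ⊆ uIcc (-(Real.pi / 2)) (Real.arctan (σR * x / σP)) := by
    rw [uIcc_of_le (by linarith), uIcc_of_le (by linarith)]
    exact Icc_subset_Icc (by linarith) hA
  have hcos : IntervalIntegrable (fun t => Real.cos t ^ β) volume (-(Real.pi / 4)) 0 := by
    refine (intervalIntegrable_cos_rpow (s := β) (a := 0) (by linarith) (by linarith)
      (by linarith)).mono_set ?_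
    rw [uIcc_of_le (by linarith), uIcc_of_le (by linarith)]
    exact Icc_subset_Icc (by linarith) le_rfl
  rw [← intervalIntegral.integral_const_mul]
  refine (intervalIntegral.integral_mono_on (by linarith) (hcos.const_mul _)
    (hint.mono_set hsub) fun t ht => le_Efun_integrand hσP hσR hp hlam hx ht).trans ?_
  refine intervalIntegral.integral_mono_interval (by linarith) (by linarith) hA ?_ hint
  filter_upwards [ae_restrict_mem measurableSet_Ioc] with t ht
  have hc : 0 ≤ Real.cos t := Real.cos_nonneg_of_mem_Icc ⟨ht.1.le, ht.2.trans hA'.le⟩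
  exact mul_nonneg (mul_nonneg (Real.rpow_nonneg hc _)
    (Real.rpow_nonneg (Efun_base_nonneg hσP ht.1 ht.2) _)) (Real.exp_pos _).le

/-- `E(x, λ) → +∞` as `x → +∞` for every `0 < λ < β + 1`
(used in Example 3.2 to discard the `E`-component of the general solution). -/
theorem Efun_tendsto_atTop
    (σP σR p r δ : ℝ)
    (hσP : 0 < σP) (hσR : 0 < σR) (hp : 0 < p) (hr : 0 < r) (hδ : 0 < δ)
    (β : ℝ)
    (hβ : β = Real.sqrt ((2 * r / σR ^ 2 - 1) ^ 2 + 8 * δ / σR ^ 2) - 1) :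
    ∀ lam : ℝ, 0 < lam → lam < β + 1 →
      Filter.Tendsto (fun x => Efun σP σR p β x lam) Filter.atTop Filter.atTop := by
  intro lam hlam hlamβ
  have hπ := Real.pi_pos
  have hI : 0 < ∫ t in (-(Real.pi / 4))..0, Real.cos t ^ β := by
    have hc : ∀ t ∈ Icc (-(Real.pi / 4)) 0, 0 < Real.cos t := fun t ht =>
      Real.cos_pos_of_mem_Ioo ⟨by linarith [ht.1], by linarith [ht.2]⟩
    refine intervalIntegral.intervalIntegral_pos_of_pos_on ?_
      (fun t ht => Real.rpow_pos_of_pos (hc t (Ioo_subset_Icc_self ht)) _) (by linarith)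
    refine ContinuousOn.intervalIntegrable_of_Icc (by linarith) ?_
    exact Real.continuous_cos.continuousOn.rpow_const fun t ht => Or.inl (hc t ht).ne'
  have hC : 0 < σP ^ (-(1 + β)) * σR ^ (-(1 + lam)) := by positivity
  have hlim : Tendsto (fun x : ℝ => σP ^ (-(1 + β)) * σR ^ (-(1 + lam)) *
      ((σR * x) ^ lam * ∫ t in (-(Real.pi / 4))..0, Real.cos t ^ β)) atTop atTop :=
    (((tendsto_rpow_atTop hlam).comp (tendsto_id.const_mul_atTop hσR)).atTop_mul_const
      hI).const_mul_atTop hC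
  refine tendsto_atTop_mono' _ ?_ hlim
  filter_upwards [eventually_ge_atTop 0] with x hx
  exact mul_le_mul_of_nonneg_left
    (rpow_mul_integral_le_Efun_integral hσP hσR hp hlam hlamβ hx) hC.le
end

section
/- Let σ_P, σ_R, p, r > 0 and δ > r. Set β = √((2r/σ_R² − 1)² + 8δ/σ_R²) − 1 and α = ½[√((2r/σ_R² − 1)² + 8δ/σ_R²) − (1 + 2r/σ_R²)] (so α > 0). Then D(0, α+1) > 0, and the function g(u) := D(u, α+1)/D(0, α+1) is twice differentiable on (0, ∞) and satisfies ½(σ_P² + σ_R² u²) g''(u) + (p + r u) g'(u) = δ g(u) for all u > 0, with g(0) = 1. If in addition α + 1 ≤ β, then also lim_{u→∞} g(u) = 0. -/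
open Real Filter MeasureTheory Set

open scoped Topology

section FundamentalSolution

variable {σP σR p β : ℝ}

/-- The integrand of `Dfun` after the substitution `y = σP tan t / σR`, without the power of the
distance to the base point. -/
noncomputable def arctanKernel (σP σR p β y : ℝ) : ℝ :=
  (σP ^ 2 + σR ^ 2 * y ^ 2) ^ (-(β / 2 + 1)) *
    Real.exp (-2 * p * Real.arctan (σR * y / σP) / (σP * σR))

lemma quadratic_pos (hσP : 0 < σP) (σR y : ℝ) : 0 < σP ^ 2 + σR ^ 2 * y ^ 2 := by positivity

lemma arctanKernel_pos (hσP : 0 < σP) (σR p β y : ℝ) : 0 < arctanKernel σP σR p β y :=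
  mul_pos (rpow_pos_of_pos (quadratic_pos hσP σR y) _) (Real.exp_pos _)

lemma hasDerivAt_quadratic (σP σR y : ℝ) :
    HasDerivAt (fun y : ℝ => σP ^ 2 + σR ^ 2 * y ^ 2) (2 * σR ^ 2 * y) y := by
  have h := (((hasDerivAt_id y).pow 2).const_mul (σR ^ 2)).const_add (σP ^ 2)
  refine h.congr_deriv ?_
  simp only [id]
  norm_num [mul_assoc, mul_left_comm]

lemma hasDerivAt_arctan_scaled (hσP : 0 < σP) (σR y : ℝ) :
    HasDerivAt (fun y : ℝ => Real.arctan (σR * y / σP))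
      (σP * σR / (σP ^ 2 + σR ^ 2 * y ^ 2)) y := by
  have h := (((hasDerivAt_id y).const_mul σR).div_const σP).arctan
  simp only [id] at h
  convert h using 1
  have := (quadratic_pos hσP σR y).ne'
  have h2 : 1 + (σR * y / σP) ^ 2 ≠ 0 := by positivity
  field_simp

lemma hasDerivAt_arctanKernel (hσP : 0 < σP) (hσR : 0 < σR) (p β y : ℝ) :
    HasDerivAt (arctanKernel σP σR p β)
      (-(((β + 2) * σR ^ 2 * y + 2 * p) / (σP ^ 2 + σR ^ 2 * y ^ 2)) *
        arctanKernel σP σR p β y) y := by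
  have hQ := (quadratic_pos hσP σR y).ne'
  have h1 := (hasDerivAt_quadratic σP σR y).rpow_const (p := -(β / 2 + 1)) (Or.inl hQ)
  have h2 := (((hasDerivAt_arctan_scaled hσP σR y).const_mul (-2 * p)).div_const (σP * σR)).exp
  refine (h1.mul h2).congr_deriv ?_
  rw [rpow_sub_one hQ, arctanKernel]
  field_simp
  ring

lemma continuous_arctanKernel (hσP : 0 < σP) (hσR : 0 < σR) (p β : ℝ) :
    Continuous (arctanKernel σP σR p β) :=
  continuous_iff_continuousAt.2 fun y => (hasDerivAt_arctanKernel hσP hσR p β y).continuousAt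

lemma arctanKernel_le (hσP : 0 < σP) (hσR : 0 < σR) (hp : 0 < p) (hβ : 0 ≤ β / 2 + 1)
    {z y : ℝ} (hz : 0 ≤ z) (hzy : z ≤ y) :
    arctanKernel σP σR p β y ≤ (σP ^ 2 + σR ^ 2 * z ^ 2) ^ (-(β / 2 + 1)) := by
  have hy : 0 ≤ y := hz.trans hzy
  have h1 : (σP ^ 2 + σR ^ 2 * y ^ 2) ^ (-(β / 2 + 1)) ≤
      (σP ^ 2 + σR ^ 2 * z ^ 2) ^ (-(β / 2 + 1)) := by
    apply rpow_le_rpow_of_nonpos (quadratic_pos hσP σR z) (by gcongr) (by linarith)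
  have h2 : Real.exp (-2 * p * Real.arctan (σR * y / σP) / (σP * σR)) ≤ 1 := by
    rw [Real.exp_le_one_iff]
    have : 0 ≤ Real.arctan (σR * y / σP) := Real.arctan_nonneg.2 (by positivity)
    apply div_nonpos_of_nonpos_of_nonneg _ (by positivity)
    nlinarith [mul_nonneg hp.le this]
  calc _ ≤ (σP ^ 2 + σR ^ 2 * y ^ 2) ^ (-(β / 2 + 1)) * 1 := by
        unfold arctanKernel
        gcongr
    _ ≤ _ := by rwa [mul_one]

lemma quadratic_rpow_le (hσR : 0 < σR) (hβ : 0 ≤ β / 2 + 1) (σP : ℝ) {z : ℝ} (hz : 0 < z) :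
    (σP ^ 2 + σR ^ 2 * z ^ 2) ^ (-(β / 2 + 1)) ≤
      (σR ^ 2) ^ (-(β / 2 + 1)) * z ^ (-(β + 2)) := by
  have h : z ^ (-(β + 2)) = (z ^ 2) ^ (-(β / 2 + 1)) := by
    rw [← rpow_natCast, ← rpow_mul hz.le]
    congr 1
    push_cast
    ring
  rw [h, ← mul_rpow (by positivity) (by positivity)]
  exact rpow_le_rpow_of_nonpos (by positivity) (by nlinarith [sq_nonneg σP]) (by linarith)

lemma integrableOn_rpow_mul_quadratic_rpow (hσP : 0 < σP) (hσR : 0 < σR) {s : ℝ}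
    (hs : -1 < s) (hsβ : s < β + 1) :
    IntegrableOn (fun z : ℝ => z ^ s * (σP ^ 2 + σR ^ 2 * z ^ 2) ^ (-(β / 2 + 1))) (Ioi 0) := by
  have hmeas : Measurable
      (fun z : ℝ => z ^ s * (σP ^ 2 + σR ^ 2 * z ^ 2) ^ (-(β / 2 + 1))) := by fun_prop
  have hb : 0 ≤ β / 2 + 1 := by linarith
  rw [← Ioc_union_Ioi_eq_Ioi zero_le_one]
  refine IntegrableOn.union ?_ ?_
  · have h := (intervalIntegral.intervalIntegrable_rpow' (a := 0) (b := 1) hs).1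
    refine Integrable.mono' (h.mul_const ((σP ^ 2) ^ (-(β / 2 + 1)))) hmeas.aestronglyMeasurable ?_
    refine (ae_restrict_mem measurableSet_Ioc).mono fun z hz => ?_
    have hz0 : 0 < z := hz.1
    rw [Real.norm_of_nonneg (by positivity)]
    gcongr 1
    exact rpow_le_rpow_of_nonpos (by positivity) (by nlinarith [sq_nonneg (σR * z)]) (by linarith)
  · have h := integrableOn_Ioi_rpow_of_lt (a := s - (β + 2)) (c := 1) (by linarith) one_pos
    refine Integrable.mono' (h.const_mul ((σR ^ 2) ^ (-(β / 2 + 1)))) hmeas.aestronglyMeasurable ?_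
    refine (ae_restrict_mem measurableSet_Ioi).mono fun z hz => ?_
    have hz0 : 0 < z := one_pos.trans hz
    rw [Real.norm_of_nonneg (by positivity)]
    calc _ ≤ z ^ s * ((σR ^ 2) ^ (-(β / 2 + 1)) * z ^ (-(β + 2))) := by
          gcongr
          exact quadratic_rpow_le hσR hb σP hz0
      _ = _ := by
          rw [sub_eq_add_neg, rpow_add hz0]
          ring

lemma norm_rpow_mul_arctanKernel_le (hσP : 0 < σP) (hσR : 0 < σR) (hp : 0 < p)
    (hβ : 0 ≤ β / 2 + 1) (s : ℝ) {x z : ℝ} (hx : 0 ≤ x) (hz : 0 ≤ z) :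
    ‖z ^ s * arctanKernel σP σR p β (x + z)‖ ≤
      z ^ s * (σP ^ 2 + σR ^ 2 * z ^ 2) ^ (-(β / 2 + 1)) := by
  have := arctanKernel_pos hσP σR p β (x + z)
  rw [Real.norm_of_nonneg (by positivity)]
  gcongr
  exact arctanKernel_le hσP hσR hp hβ hz (by linarith)

lemma measurable_rpow_mul_arctanKernel (hσP : 0 < σP) (hσR : 0 < σR) (p β s x : ℝ) :
    Measurable fun z : ℝ => z ^ s * arctanKernel σP σR p β (x + z) := by
  have h := (continuous_arctanKernel hσP hσR p β).measurable
  fun_prop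

lemma integrableOn_rpow_mul_arctanKernel (hσP : 0 < σP) (hσR : 0 < σR) (hp : 0 < p) {s x : ℝ}
    (hs : -1 < s) (hsβ : s < β + 1) (hx : 0 ≤ x) :
    IntegrableOn (fun z : ℝ => z ^ s * arctanKernel σP σR p β (x + z)) (Ioi 0) := by
  refine Integrable.mono' (integrableOn_rpow_mul_quadratic_rpow hσP hσR hs hsβ)
    (measurable_rpow_mul_arctanKernel hσP hσR p β s x).aestronglyMeasurable ?_
  refine (ae_restrict_mem measurableSet_Ioi).mono fun z hz => ?_
  exact norm_rpow_mul_arctanKernel_le hσP hσR hp (by linarith) s hx (le_of_lt hz)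

lemma tendsto_rpow_mul_arctanKernel (hσP : 0 < σP) (hσR : 0 < σR) (hp : 0 < p) {s x : ℝ}
    (hβ : 0 ≤ β / 2 + 1) (hsβ : s < β + 2) (hx : 0 ≤ x) :
    Tendsto (fun z : ℝ => z ^ s * arctanKernel σP σR p β (x + z)) atTop (𝓝 0) := by
  have h := (tendsto_rpow_neg_atTop (y := β + 2 - s) (by linarith)).const_mul
    ((σR ^ 2) ^ (-(β / 2 + 1)))
  rw [mul_zero] at h
  refine squeeze_zero_norm' ?_ h
  filter_upwards [eventually_gt_atTop 0] with z hz
  calc _ ≤ z ^ s * (σP ^ 2 + σR ^ 2 * z ^ 2) ^ (-(β / 2 + 1)) :=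
        norm_rpow_mul_arctanKernel_le hσP hσR hp hβ s hx hz.le
    _ ≤ z ^ s * ((σR ^ 2) ^ (-(β / 2 + 1)) * z ^ (-(β + 2))) := by
        gcongr
        exact quadratic_rpow_le hσR hβ σP hz
    _ = _ := by
        rw [show -(β + 2 - s) = s + -(β + 2) by ring, rpow_add hz]
        ring

lemma tendsto_arctanKernel (hσP : 0 < σP) (hσR : 0 < σR) (hp : 0 < p) (hβ : 0 ≤ β) :
    Tendsto (arctanKernel σP σR p β) atTop (𝓝 0) := by
  simpa using tendsto_rpow_mul_arctanKernel (s := 0) (x := 0) hσP hσR hp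
    (by linarith : 0 ≤ β / 2 + 1) (by linarith) le_rfl

/-- `Dfun` in the variable `z = σP tan t / σR - x`. -/
lemma Dfun_eq_integral (hσP : 0 < σP) (hσR : 0 < σR) (p β x s : ℝ) :
    Dfun σP σR p β x s = ∫ z in Ioi (0 : ℝ), z ^ s * arctanKernel σP σR p β (x + z) := by
  have himage : (fun z : ℝ => Real.arctan (σR * (x + z) / σP)) '' Ioi 0 =
      Ioo (Real.arctan (σR * x / σP)) (Real.pi / 2) := by
    ext t
    constructor
    · rintro ⟨z, hz, rfl⟩
      refine ⟨Real.arctan_strictMono ?_, Real.arctan_lt_pi_div_two _⟩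
      have : x < x + z := lt_add_of_pos_right x hz
      gcongr
    · rintro ⟨h1, h2⟩
      have h0 : -(Real.pi / 2) < t := (Real.neg_pi_div_two_lt_arctan _).trans h1
      refine ⟨σP * Real.tan t / σR - x, ?_, ?_⟩
      · rw [← Real.arctan_tan h0 h2, Real.arctan_lt_arctan_iff, div_lt_iff₀ hσP] at h1
        rw [mem_Ioi, sub_pos, lt_div_iff₀ hσR]
        linarith
      · have : σR * (x + (σP * Real.tan t / σR - x)) / σP = Real.tan t := by
          field_simp
          ring
        simp only [this]
        exact Real.arctan_tan h0 h2
  have hinj : InjOn (fun z : ℝ => Real.arctan (σR * (x + z) / σP)) (Ioi 0) := by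
    intro a _ b _ hab
    have h := Real.arctan_injective hab
    field_simp at h
    linarith
  unfold Dfun
  rw [intervalIntegral.integral_of_le (Real.arctan_lt_pi_div_two _).le,
    integral_Ioc_eq_integral_Ioo, ← himage,
    integral_image_eq_integral_abs_deriv_smul measurableSet_Ioi
      (fun z _ => ((hasDerivAt_arctan_scaled hσP σR (x + z)).comp_const_add x z).hasDerivWithinAt)
      hinj, ← integral_const_mul]
  refine setIntegral_congr_fun measurableSet_Ioi fun z (hz : 0 < z) => ?_
  have hQ := quadratic_pos hσP σR (x + z)
  set Q := σP ^ 2 + σR ^ 2 * (x + z) ^ 2 with hQdef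
  have hsqrt : √(1 + (σR * (x + z) / σP) ^ 2) = √Q / σP := by
    rw [← Real.sqrt_sq hσP.le, ← Real.sqrt_div hQ.le, Real.sqrt_sq hσP.le, hQdef]
    congr 1
    field_simp
  have hcos : Real.cos (Real.arctan (σR * (x + z) / σP)) = σP / √Q := by
    rw [Real.cos_arctan, hsqrt, one_div_div]
  have hq : 0 < √Q := Real.sqrt_pos.2 hQ
  have hlin : σP * Real.sin (Real.arctan (σR * (x + z) / σP)) -
      σR * x * Real.cos (Real.arctan (σR * (x + z) / σP)) = σP / √Q * (σR * z) := by
    rw [hcos, Real.sin_arctan, hsqrt]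
    field_simp
    ring
  have hpow : Q ^ (-(β / 2 + 1)) = √Q ^ (-β) * Q⁻¹ := by
    rw [neg_add, rpow_add hQ, rpow_neg_one, Real.sqrt_eq_rpow, ← rpow_mul hQ.le]
    congr 2
    ring
  have hσPpow : σP ^ (-(1 + β)) = (σP ^ β)⁻¹ * σP⁻¹ := by
    rw [rpow_neg hσP.le, add_comm, rpow_add hσP, rpow_one, mul_inv]
  have hσRpow : σR ^ (-(1 + s)) = (σR ^ s)⁻¹ * σR⁻¹ := by
    rw [rpow_neg hσR.le, add_comm, rpow_add hσR, rpow_one, mul_inv]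
  have hcospow : (σP / √Q) ^ (β - s) * (σP / √Q * (σR * z)) ^ s =
      σP ^ β * √Q ^ (-β) * (σR ^ s * z ^ s) := by
    rw [mul_rpow (by positivity) (by positivity), ← mul_assoc, ← rpow_add (by positivity),
      mul_rpow hσR.le hz.le, div_rpow hσP.le hq.le, rpow_neg hq.le]
    ring_nf
  simp only [smul_eq_mul]
  rw [hlin, hcos, hcospow, abs_of_pos (by positivity), hσPpow, hσRpow, arctanKernel, ← hQdef, hpow]
  have h1 : σP ^ β ≠ 0 := (rpow_pos_of_pos hσP β).ne'
  have h2 : σR ^ s ≠ 0 := (rpow_pos_of_pos hσR s).ne'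
  field_simp

lemma Dfun_pos (hσP : 0 < σP) (hσR : 0 < σR) (hp : 0 < p) {s x : ℝ}
    (hs : -1 < s) (hsβ : s < β + 1) (hx : 0 ≤ x) : 0 < Dfun σP σR p β x s := by
  rw [Dfun_eq_integral hσP hσR, setIntegral_pos_iff_support_of_nonneg_ae]
  · have hsub : Ioi (0 : ℝ) ⊆
        Function.support fun z : ℝ => z ^ s * arctanKernel σP σR p β (x + z) := fun z hz =>
      (mul_pos (rpow_pos_of_pos hz s) (arctanKernel_pos hσP σR p β (x + z))).ne'
    rw [inter_eq_right.2 hsub, Real.volume_Ioi]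
    exact ENNReal.zero_lt_top
  · refine (ae_restrict_mem measurableSet_Ioi).mono fun z hz => ?_
    exact (mul_pos (rpow_pos_of_pos hz s) (arctanKernel_pos hσP σR p β (x + z))).le
  · exact integrableOn_rpow_mul_arctanKernel hσP hσR hp hs hsβ hx

lemma tendsto_Dfun_atTop (hσP : 0 < σP) (hσR : 0 < σR) (hp : 0 < p) (hβ : 0 ≤ β) {s : ℝ}
    (hs : -1 < s) (hsβ : s < β + 1) :
    Tendsto (fun x => Dfun σP σR p β x s) atTop (𝓝 0) := by
  simp only [Dfun_eq_integral hσP hσR]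
  have hlim := tendsto_integral_filter_of_dominated_convergence (l := atTop)
    (μ := volume.restrict (Ioi (0 : ℝ))) (f := fun _ => 0)
    (F := fun x z => z ^ s * arctanKernel σP σR p β (x + z)) _ ?_ ?_
    (integrableOn_rpow_mul_quadratic_rpow hσP hσR hs hsβ) ?_
  · simpa using hlim
  · exact Eventually.of_forall fun x =>
      (measurable_rpow_mul_arctanKernel hσP hσR p β s x).aestronglyMeasurable
  · filter_upwards [eventually_ge_atTop 0] with x hx
    refine (ae_restrict_mem measurableSet_Ioi).mono fun z hz => ?_
    exact norm_rpow_mul_arctanKernel_le hσP hσR hp (by linarith) s hx (le_of_lt hz)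
  · refine Eventually.of_forall fun z => ?_
    have h := ((tendsto_arctanKernel hσP hσR hp hβ).comp
      (tendsto_atTop_add_const_right atTop z tendsto_id)).const_mul (z ^ s)
    simpa using h

lemma hasDerivAt_Dfun (hσP : 0 < σP) (hσR : 0 < σR) (hp : 0 < p) {s x : ℝ}
    (hs : 0 < s) (hsβ : s < β + 1) (hx : 0 < x) :
    HasDerivAt (fun x => Dfun σP σR p β x s) (-s * Dfun σP σR p β x (s - 1)) x := by
  simp only [Dfun_eq_integral hσP hσR]
  set M : ℝ := (β + 2) * σR / (2 * σP) + 2 * p / σP ^ 2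
  have hMbound : ∀ y : ℝ, 0 ≤ y →
      ((β + 2) * σR ^ 2 * y + 2 * p) / (σP ^ 2 + σR ^ 2 * y ^ 2) ≤ M := by
    intro y hy
    have hQ := quadratic_pos hσP σR y
    rw [add_div]
    have hβ2 : 0 < β + 2 := by linarith
    refine add_le_add ?_ ?_
    · rw [div_le_div_iff₀ hQ (by positivity)]
      have : 0 ≤ (β + 2) * σR * (σP - σR * y) ^ 2 := by positivity
      linarith
    · gcongr
      nlinarith [sq_nonneg (σR * y)]
  have hmeas : Measurable fun z : ℝ => z ^ s *
      (-(((β + 2) * σR ^ 2 * (x + z) + 2 * p) / (σP ^ 2 + σR ^ 2 * (x + z) ^ 2)) *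
        arctanKernel σP σR p β (x + z)) := by
    have h := (continuous_arctanKernel hσP hσR p β).measurable
    fun_prop
  obtain ⟨hint, hderiv⟩ := hasDerivAt_integral_of_dominated_loc_of_deriv_le
    (μ := volume.restrict (Ioi (0 : ℝ))) (s := Ioi 0) (x₀ := x)
    (F := fun x z => z ^ s * arctanKernel σP σR p β (x + z))
    (F' := fun x z => z ^ s *
      (-(((β + 2) * σR ^ 2 * (x + z) + 2 * p) / (σP ^ 2 + σR ^ 2 * (x + z) ^ 2)) *
        arctanKernel σP σR p β (x + z)))
    (bound := fun z => M * (z ^ s * (σP ^ 2 + σR ^ 2 * z ^ 2) ^ (-(β / 2 + 1))))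
    (Ioi_mem_nhds hx)
    (Eventually.of_forall fun x =>
      (measurable_rpow_mul_arctanKernel hσP hσR p β s x).aestronglyMeasurable)
    (integrableOn_rpow_mul_arctanKernel hσP hσR hp (by linarith) hsβ hx.le)
    hmeas.aestronglyMeasurable
    ((ae_restrict_mem measurableSet_Ioi).mono fun z (hz : 0 < z) y (hy : 0 < y) => by
      have hβ2 : 0 < β + 2 := by linarith
      have hQ := quadratic_pos hσP σR (y + z)
      have hb := hMbound (y + z) (by positivity)
      have hnn : 0 ≤ ((β + 2) * σR ^ 2 * (y + z) + 2 * p) / (σP ^ 2 + σR ^ 2 * (y + z) ^ 2) := by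
        positivity
      rw [mul_left_comm, norm_mul, norm_neg, Real.norm_of_nonneg hnn]
      exact mul_le_mul hb (norm_rpow_mul_arctanKernel_le hσP hσR hp (by linarith) s hy.le hz.le)
        (norm_nonneg _) (hnn.trans hb))
    ((integrableOn_rpow_mul_quadratic_rpow hσP hσR (by linarith) hsβ).const_mul M)
    (Eventually.of_forall fun z y _ =>
      ((hasDerivAt_arctanKernel hσP hσR p β (y + z)).comp_add_const y z).const_mul (z ^ s))
  refine hderiv.congr_deriv ?_
  have hint' := (integrableOn_rpow_mul_arctanKernel (β := β) hσP hσR hp (s := s - 1)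
    (by linarith) (by linarith) hx.le).const_mul s
  have hparts := integral_Ioi_of_hasDerivAt_of_tendsto (a := 0) (m := 0)
    (f := fun z : ℝ => z ^ s * arctanKernel σP σR p β (x + z)) ?_
    (fun z (hz : 0 < z) => (Real.hasDerivAt_rpow_const (p := s) (Or.inl hz.ne')).mul
      ((hasDerivAt_arctanKernel hσP hσR p β (x + z)).comp_const_add x z)) ?_
    (tendsto_rpow_mul_arctanKernel hσP hσR hp (by linarith) (by linarith) hx.le)
  · simp only [mul_assoc s] at hparts
    rw [integral_add hint' hint, integral_const_mul, zero_rpow hs.ne', zero_mul] at hparts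
    linarith
  · have h := continuous_arctanKernel hσP hσR p β
    have h2 := Real.continuous_rpow_const hs.le
    exact (h2.mul (h.comp (continuous_const_add x))).continuousWithinAt
  · simp only [mul_assoc s]
    exact hint'.add hint

lemma Dfun_moment_identity (hσP : 0 < σP) (hσR : 0 < σR) (hp : 0 < p) {r δ α x : ℝ}
    (hα : 0 < α) (hαβ : α < β) (hx : 0 < x)
    (hr : β / 2 * σR ^ 2 = α * σR ^ 2 + r)
    (hδ : δ = (α + 1) * α * σR ^ 2 / 2 + r * (α + 1)) :
    1 / 2 * (σP ^ 2 + σR ^ 2 * x ^ 2) * ((α + 1) * α * Dfun σP σR p β x (α - 1))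
      - (p + r * x) * ((α + 1) * Dfun σP σR p β x α) = δ * Dfun σP σR p β x (α + 1) := by
  simp only [Dfun_eq_integral hσP hσR]
  have hint : ∀ s, -1 < s → s < β + 1 → _ := fun s h1 h2 =>
    integrableOn_rpow_mul_arctanKernel (β := β) hσP hσR hp (s := s) h1 h2 hx.le
  have hI0 := (hint (α - 1) (by linarith) (by linarith)).const_mul
    (1 / 2 * (σP ^ 2 + σR ^ 2 * x ^ 2) * ((α + 1) * α))
  have hI1 := (hint α (by linarith) (by linarith)).const_mul ((p + r * x) * (α + 1))
  have hI2 := (hint (α + 1) (by linarith) (by linarith)).const_mul δ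
  have hI01 := hI0.sub hI1
  simp only [Pi.sub_def] at hI01
  have hI012 := hI01.sub hI2
  simp only [Pi.sub_def] at hI012
  have hkernel : ∀ y, (σP ^ 2 + σR ^ 2 * y ^ 2) * arctanKernel σP σR p β y =
      arctanKernel σP σR p (β - 2) y := by
    intro y
    have hQ := quadratic_pos hσP σR y
    rw [arctanKernel, arctanKernel, ← mul_assoc, show -((β - 2) / 2 + 1) = 1 + -(β / 2 + 1) by ring,
      rpow_add hQ, rpow_one]
  have hparts := integral_Ioi_of_hasDerivAt_of_tendsto (a := 0) (m := 0)
    (f := fun z : ℝ => (α + 1) / 2 * (z ^ α * arctanKernel σP σR p (β - 2) (x + z)))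
    (f' := fun z => 1 / 2 * (σP ^ 2 + σR ^ 2 * x ^ 2) * ((α + 1) * α) *
        (z ^ (α - 1) * arctanKernel σP σR p β (x + z)) -
      (p + r * x) * (α + 1) * (z ^ α * arctanKernel σP σR p β (x + z)) -
      δ * (z ^ (α + 1) * arctanKernel σP σR p β (x + z))) ?_ ?_
    hI012 ?_
  · rw [integral_sub hI01 hI2, integral_sub hI0 hI1, integral_const_mul,
      integral_const_mul, integral_const_mul, zero_rpow hα.ne', zero_mul, mul_zero] at hparts
    linarith
  · have h := continuous_arctanKernel hσP hσR p (β - 2)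
    have h2 := Real.continuous_rpow_const hα.le
    exact ((h2.mul (h.comp (continuous_const_add x))).const_mul _).continuousWithinAt
  · intro z (hz : 0 < z)
    have h := ((Real.hasDerivAt_rpow_const (p := α) (Or.inl hz.ne')).mul
      ((hasDerivAt_arctanKernel hσP hσR p (β - 2) (x + z)).comp_const_add x z)).const_mul
        ((α + 1) / 2)
    refine h.congr_deriv ?_
    have hQ := (quadratic_pos hσP σR (x + z)).ne'
    rw [← hkernel, rpow_add_one hz.ne', rpow_sub_one hz.ne', hδ]
    have hr' : r = β / 2 * σR ^ 2 - α * σR ^ 2 := by linarith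
    rw [hr']
    field_simp
    ring
  · have h := (tendsto_rpow_mul_arctanKernel (β := β - 2) (s := α) hσP hσR hp (by linarith)
      (by linarith) hx.le).const_mul ((α + 1) / 2)
    simpa using h

end FundamentalSolution

/-- Example 3.2 with `ρ = 0`: `g(u) = D(u, α+1)/D(0, α+1)`
solves `½(σP² + σR² u²)g'' + (p + ru)g' = δ g` on `(0, ∞)` with `g(0) = 1`,
and (if `α + 1 ≤ β`) `g(u) → 0` as `u → ∞`. -/
theorem GerberShiu_explicit_solution
    (σP σR p r δ : ℝ)
    (hσP : 0 < σP) (hσR : 0 < σR) (hp : 0 < p) (hr : 0 < r) (hδ : r < δ)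
    (β α : ℝ)
    (hβ : β = Real.sqrt ((2 * r / σR ^ 2 - 1) ^ 2 + 8 * δ / σR ^ 2) - 1)
    (hα : α = (Real.sqrt ((2 * r / σR ^ 2 - 1) ^ 2 + 8 * δ / σR ^ 2)
        - (1 + 2 * r / σR ^ 2)) / 2)
    (g : ℝ → ℝ)
    (hg : g = fun u => Dfun σP σR p β u (α + 1) / Dfun σP σR p β 0 (α + 1)) :
    0 < α ∧
    0 < Dfun σP σR p β 0 (α + 1) ∧
    (∀ u ∈ Set.Ioi (0 : ℝ),
      DifferentiableAt ℝ g u ∧ DifferentiableAt ℝ (deriv g) u) ∧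
    (∀ u > (0 : ℝ),
      (1 / 2) * (σP ^ 2 + σR ^ 2 * u ^ 2) * deriv (deriv g) u
        + (p + r * u) * deriv g u = δ * g u) ∧
    g 0 = 1 ∧
    (α + 1 ≤ β → Filter.Tendsto g Filter.atTop (nhds 0)) := by
  have ha : 0 < 2 * r / σR ^ 2 := by positivity
  have hrδ : 4 * (2 * r / σR ^ 2) < 8 * δ / σR ^ 2 := by
    rw [← mul_div_assoc]
    exact div_lt_div_of_pos_right (by linarith) (by positivity)
  have hS0 := Real.sqrt_nonneg ((2 * r / σR ^ 2 - 1) ^ 2 + 8 * δ / σR ^ 2)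
  have hS2 := Real.sq_sqrt (x := (2 * r / σR ^ 2 - 1) ^ 2 + 8 * δ / σR ^ 2)
    (by linarith [sq_nonneg (2 * r / σR ^ 2 - 1)])
  set S := √((2 * r / σR ^ 2 - 1) ^ 2 + 8 * δ / σR ^ 2)
  have hS : 2 * r / σR ^ 2 + 1 < S := lt_of_pow_lt_pow_left₀ 2 hS0 (by rw [hS2]; linarith)
  have hα0 : 0 < α := by linarith
  have hαβ : α < β := by linarith
  have haR : 2 * r / σR ^ 2 * σR ^ 2 = 2 * r := by field_simp
  have hδR : 8 * δ / σR ^ 2 * σR ^ 2 = 8 * δ := by field_simp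
  have hr_eq : β / 2 * σR ^ 2 = α * σR ^ 2 + r := by
    rw [hβ, hα]
    linear_combination haR / 2
  have hδ_eq : δ = (α + 1) * α * σR ^ 2 / 2 + r * (α + 1) := by
    rw [hα]
    linear_combination -hδR / 8 - σR ^ 2 / 8 * hS2 + (S + 1 - 2 * r / σR ^ 2) / 4 * haR
  have hD0 := Dfun_pos (β := β) hσP hσR hp (s := α + 1) (by linarith) (by linarith) le_rfl
  have hg' : ∀ u, 0 < u → HasDerivAt g
      (-(α + 1) * Dfun σP σR p β u α / Dfun σP σR p β 0 (α + 1)) u := by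
    intro u hu
    have h := (hasDerivAt_Dfun (β := β) hσP hσR hp (s := α + 1) (by linarith) (by linarith)
      hu).div_const (Dfun σP σR p β 0 (α + 1))
    rwa [add_sub_cancel_right, ← hg] at h
  have hg'' : ∀ u, 0 < u → HasDerivAt (deriv g)
      (-(α + 1) * (-α * Dfun σP σR p β u (α - 1)) / Dfun σP σR p β 0 (α + 1)) u := by
    intro u hu
    have h := ((hasDerivAt_Dfun (β := β) hσP hσR hp hα0 (by linarith) hu).const_mul
      (-(α + 1))).div_const (Dfun σP σR p β 0 (α + 1))
    refine h.congr_of_eventuallyEq ?_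
    filter_upwards [Ioi_mem_nhds hu] with v hv
    exact (hg' v hv).deriv
  refine ⟨hα0, hD0, fun u hu => ⟨(hg' u hu).differentiableAt, (hg'' u hu).differentiableAt⟩,
    fun u hu => ?_, ?_, fun _ => ?_⟩
  · rw [(hg'' u hu).deriv, (hg' u hu).deriv, hg]
    have h := Dfun_moment_identity hσP hσR hp hα0 hαβ hu hr_eq hδ_eq
    field_simp
    linear_combination 2 * h
  · rw [hg]
    exact div_self hD0.ne'
  · rw [hg]
    simpa using (tendsto_Dfun_atTop (β := β) hσP hσR hp (by linarith) (s := α + 1)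
      (by linarith) (by linarith)).div_const (Dfun σP σR p β 0 (α + 1))
end
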